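/- arXiv:1411.0852 — 8 statements merged into one kernel-verified Lean document; each statement's English description precedes it below -/
import Mathlib

section
/- Let γ be a negative gradient trajectory of f. Then for all real numbers a ≤ b, ‖γ(b) − γ(a)‖ ≤ √(b − a) · √(f(γ(a)) − f(γ(b))). -/
open Filter
open scoped Topology

/-- Distance estimate along a negative gradient trajectory:
if `γ` is a negative gradient trajectory of `f` (a differentiable function on a real
Hilbert space with continuous gradient), then for all `a ≤ b`,
`‖γ b - γ a‖ ≤ √(b - a) · √(f (γ a) - f (γ b))`. -/
theorem dist_le_of_negGradientTrajectory
    {E : Type*} [NormedAddCommGroup E] [InnerProductSpace ℝ E] [CompleteSpace E]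
    (f : E → ℝ) (hf : Differentiable ℝ f) (hgrad : Continuous (gradient f))
    (γ : ℝ → E) (hγ : ∀ t : ℝ, HasDerivAt γ (-(gradient f (γ t))) t) :
    ∀ a b : ℝ, a ≤ b →
      ‖γ b - γ a‖ ≤ Real.sqrt (b - a) * Real.sqrt (f (γ a) - f (γ b)) := by
  intro a b hab
  rcases hab.eq_or_lt with rfl | hlt
  · simp
  have hT : 0 < b - a := sub_pos.mpr hlt
  -- the auxiliary function below is antitone, its derivative is `-‖(b - a) • ∇f + v‖ ^ 2`
  have hd : ∀ v : E, ∀ t : ℝ, HasDerivAt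
      (fun t => (b - a) ^ 2 * f (γ t) + 2 * (b - a) * inner ℝ v (γ t) - t * ‖v‖ ^ 2)
      (-‖(b - a) • gradient f (γ t) + v‖ ^ 2) t := by
    intro v t
    have h1 : HasDerivAt (fun t => f (γ t)) (-‖gradient f (γ t)‖ ^ 2) t := by
      have h := (hf (γ t)).hasGradientAt.hasFDerivAt.comp_hasDerivAt t (hγ t)
      refine h.congr_deriv ?_
      rw [map_neg, InnerProductSpace.toDual_apply_apply, real_inner_self_eq_norm_sq]
    have h2 : HasDerivAt (fun t => inner ℝ v (γ t)) (-inner ℝ v (gradient f (γ t))) t := by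
      have h := (innerSL ℝ v).hasFDerivAt.comp_hasDerivAt t (hγ t)
      simpa [Function.comp_def] using h
    have h3 := ((h1.const_mul ((b - a) ^ 2)).add (h2.const_mul (2 * (b - a)))).sub
      ((hasDerivAt_id t).mul_const (‖v‖ ^ 2))
    refine h3.congr_deriv ?_
    rw [norm_add_sq_real, norm_smul, real_inner_smul_left, real_inner_comm, mul_pow,
      Real.norm_eq_abs, sq_abs]
    ring
  have hanti := antitone_of_hasDerivAt_nonpos (hd (γ b - γ a))
    (fun t => by simp only [Pi.zero_apply]; linarith [sq_nonneg ‖(b - a) • gradient f (γ t) + (γ b - γ a)‖])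
  have h := hanti hab
  have hv : inner ℝ (γ b - γ a) (γ b) - inner ℝ (γ b - γ a) (γ a) = ‖γ b - γ a‖ ^ 2 := by
    rw [← inner_sub_right, real_inner_self_eq_norm_sq]
  have key : ‖γ b - γ a‖ ^ 2 ≤ (b - a) * (f (γ a) - f (γ b)) := by
    have h' : 0 ≤ (b - a) * ((b - a) * (f (γ a) - f (γ b)) - ‖γ b - γ a‖ ^ 2) := by
      have e : 2 * (b - a) * inner ℝ (γ b - γ a) (γ b)
          = 2 * (b - a) * (inner ℝ (γ b - γ a) (γ a) + ‖γ b - γ a‖ ^ 2) := by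
        rw [← hv]; ring
      simp only at h
      rw [e] at h
      linarith
    linarith [nonneg_of_mul_nonneg_right h' hT]
  rw [← Real.sqrt_mul hT.le]
  exact Real.le_sqrt_of_sq_le key
end

section
/- Let γ be a negative gradient trajectory of f and suppose γ(t) → p in E as t → −∞. Then f(γ(t)) ≤ f(p) for all t ∈ ℝ, and for every b ∈ ℝ the (Lebesgue) integral of ‖γ'(t)‖² over (−∞, b] is at most f(p) − f(γ(b)). -/
open Filter MeasureTheory
open scoped Topology ENNReal

/-- If a negative gradient trajectory `γ` of `f` (differentiable with continuous
gradient on a real Hilbert space) converges to `p` as `t → -∞`, then `f (γ t) ≤ f p`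
for all `t`, and for every `b` the Lebesgue integral of `‖γ'(t)‖²` over `(-∞, b]` is
at most `f p - f (γ b)`. -/
theorem energy_bound_of_negGradientTrajectory_limit_atBot
    {E : Type*} [NormedAddCommGroup E] [InnerProductSpace ℝ E] [CompleteSpace E]
    (f : E → ℝ) (hf : Differentiable ℝ f) (hgrad : Continuous (gradient f))
    (γ : ℝ → E) (hγ : ∀ t : ℝ, HasDerivAt γ (-(gradient f (γ t))) t)
    (p : E) (hlim : Tendsto γ atBot (𝓝 p)) :
    (∀ t : ℝ, f (γ t) ≤ f p) ∧
    ∀ b : ℝ,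
      ∫⁻ t in Set.Iic b, ENNReal.ofReal (‖deriv γ t‖ ^ 2)
        ≤ ENNReal.ofReal (f p - f (γ b)) := by
  have hder : ∀ t, HasDerivAt (fun t => -f (γ t)) (‖gradient f (γ t)‖ ^ 2) t := by
    intro t
    have h1 := ((hf (γ t)).hasGradientAt.hasFDerivAt.comp_hasDerivAt t (hγ t)).neg
    refine h1.congr_deriv ?_
    rw [InnerProductSpace.toDual_apply_apply, inner_neg_right, neg_neg,
      real_inner_self_eq_norm_sq]
  have hγc : Continuous γ := continuous_iff_continuousAt.2 fun t => (hγ t).continuousAt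
  have hGc : Continuous (fun t => ‖gradient f (γ t)‖ ^ 2) := by fun_prop
  have hmono : Monotone (fun t => -f (γ t)) := by
    apply monotone_of_deriv_nonneg (fun t => (hder t).differentiableAt)
    intro t
    rw [(hder t).deriv]
    positivity
  have hl : Tendsto (fun t => -f (γ t)) atBot (𝓝 (-f p)) :=
    ((hf p).continuousAt.tendsto.comp hlim).neg
  have hle : ∀ t, f (γ t) ≤ f p := fun t => by
    have := hmono.le_of_tendsto hl t
    linarith
  refine ⟨hle, fun b => ?_⟩
  have hint : IntegrableOn (fun t => ‖gradient f (γ t)‖ ^ 2) (Set.Iic b) := by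
    refine integrableOn_Iic_of_intervalIntegral_norm_bounded (f p - f (γ b)) b
      (fun a => (hGc.integrableOn_Icc (a := a)).mono_set Set.Ioc_subset_Icc_self)
      tendsto_id (Eventually.of_forall fun a => ?_)
    have h2 := intervalIntegral.integral_eq_sub_of_hasDerivAt (a := a) (b := b)
      (fun t _ => hder t) (hGc.intervalIntegrable _ _)
    simp only [norm_pow, norm_norm]
    rw [h2]
    linarith [hle a]
  have hI := integral_Iic_of_hasDerivAt_of_tendsto' (fun t _ => hder t) hint hl
  have hd : ∀ t, ‖deriv γ t‖ ^ 2 = ‖gradient f (γ t)‖ ^ 2 := fun t => by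
    rw [(hγ t).deriv, norm_neg]
  simp only [hd]
  rw [← ofReal_integral_eq_lintegral_ofReal hint
    (Eventually.of_forall fun t => by positivity), hI]
  exact ENNReal.ofReal_le_ofReal (by linarith)
end

section
/- Let (γ_n) be a sequence of negative gradient trajectories of f which converges to a map γ : ℝ → E uniformly on every compact subset of ℝ. Then γ is a negative gradient trajectory of f, and the derivatives γ_n' converge to γ' uniformly on every compact subset of ℝ. -/
open Filter
open scoped Topology

/-- If a sequence of negative gradient trajectories of `f` (differentiable with
continuous gradient on a real Hilbert space) converges to a map `γ` uniformly on
every compact subset of `ℝ`, then `γ` is also a negative gradient trajectory of `f`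
and the derivatives converge uniformly on every compact subset of `ℝ`. -/
theorem negGradientTrajectory_of_locallyUniform_limit
    {E : Type*} [NormedAddCommGroup E] [InnerProductSpace ℝ E] [CompleteSpace E]
    (f : E → ℝ) (hf : Differentiable ℝ f) (hgrad : Continuous (gradient f))
    (γseq : ℕ → ℝ → E)
    (hγseq : ∀ n : ℕ, ∀ t : ℝ, HasDerivAt (γseq n) (-(gradient f (γseq n t))) t)
    (γ : ℝ → E)
    (hconv : ∀ K : Set ℝ, IsCompact K → TendstoUniformlyOn γseq γ atTop K) :
    (∀ t : ℝ, HasDerivAt γ (-(gradient f (γ t))) t) ∧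
    ∀ K : Set ℝ, IsCompact K →
      TendstoUniformlyOn (fun n => deriv (γseq n)) (deriv γ) atTop K := by
  have hL : TendstoLocallyUniformly γseq γ atTop :=
    tendstoLocallyUniformly_iff_forall_isCompact.2 hconv
  have hcont : Continuous γ :=
    hL.continuous (Frequently.of_forall fun n =>
      continuous_iff_continuousAt.2 fun t => (hγseq n t).continuousAt)
  have hG : Continuous (fun x => -(gradient f x)) := hgrad.neg
  have hD : ∀ K : Set ℝ, IsCompact K →
      TendstoUniformlyOn (fun n t => -(gradient f (γseq n t)))
        (fun t => -(gradient f (γ t))) atTop K := by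
    intro K hK u hu
    have h1 := (hK.image hcont).uniformContinuousAt_of_continuousAt
      (fun x => -(gradient f x)) (fun x _ => hG.continuousAt) hu
    filter_upwards [hconv K hK _ h1] with n hn t ht
    exact hn t ht ⟨t, ht, rfl⟩
  have hγ : ∀ t : ℝ, HasDerivAt γ (-(gradient f (γ t))) t := by
    intro t
    refine hasDerivAt_of_tendstoLocallyUniformlyOn (l := atTop) (f := γseq)
      (f' := fun n t => -(gradient f (γseq n t)))
      (g' := fun t => -(gradient f (γ t))) isOpen_univ ?_
      (Eventually.of_forall fun n x _ => hγseq n x) ?_ (Set.mem_univ t)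
    · exact (tendstoLocallyUniformly_iff_forall_isCompact.2 hD).tendstoLocallyUniformlyOn
    · intro x _
      exact (hconv {x} isCompact_singleton).tendsto_at rfl
  refine ⟨hγ, fun K hK => ?_⟩
  have e1 : (fun n => deriv (γseq n)) = fun n t => -(gradient f (γseq n t)) := by
    funext n t
    exact (hγseq n t).deriv
  have e2 : deriv γ = fun t => -(gradient f (γ t)) := by
    funext t
    exact (hγ t).deriv
  rw [e1, e2]
  exact hD K hK
end

section
/- Suppose in addition that f is bounded on E and let K ⊆ E be a compact set. Then every sequence (γ_n) of negative gradient trajectories of f whose images all lie in K has a subsequence which converges, uniformly on every compact subset of ℝ, to a negative gradient trajectory of f with image contained in K. -/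
open Filter
open scoped Topology

/-- Compactness of the space of negative gradient trajectories:
if `f` is bounded (differentiable with continuous gradient on a real Hilbert space)
and `K ⊆ E` is compact, then every sequence of negative gradient trajectories of `f`
with image in `K` has a subsequence converging uniformly on every compact subset of
`ℝ` to a negative gradient trajectory of `f` with image in `K`. -/
theorem negGradientTrajectory_compactness
    {E : Type*} [NormedAddCommGroup E] [InnerProductSpace ℝ E] [CompleteSpace E]
    (f : E → ℝ) (hf : Differentiable ℝ f) (hgrad : Continuous (gradient f))
    (hbdd : ∃ C : ℝ, ∀ x : E, |f x| ≤ C)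
    (K : Set E) (hK : IsCompact K)
    (γseq : ℕ → ℝ → E)
    (hγseq : ∀ n : ℕ, ∀ t : ℝ, HasDerivAt (γseq n) (-(gradient f (γseq n t))) t)
    (hmem : ∀ n : ℕ, ∀ t : ℝ, γseq n t ∈ K) :
    ∃ φ : ℕ → ℕ, StrictMono φ ∧ ∃ γ : ℝ → E,
      (∀ t : ℝ, HasDerivAt γ (-(gradient f (γ t))) t) ∧
      (∀ t : ℝ, γ t ∈ K) ∧
      ∀ S : Set ℝ, IsCompact S →
        TendstoUniformlyOn (fun n => γseq (φ n)) γ atTop S := by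
  obtain ⟨C, hC⟩ := hK.exists_bound_of_continuousOn hgrad.continuousOn
  have hLip : ∀ n, LipschitzWith C.toNNReal (γseq n) := by
    intro n
    refine lipschitzWith_of_nnnorm_deriv_le (fun t => (hγseq n t).differentiableAt) fun t => ?_
    rw [(hγseq n t).deriv, nnnorm_neg, ← norm_toNNReal]
    exact Real.toNNReal_le_toNNReal (hC _ (hmem n t))
  let S : Set C(ℝ, E) := {g | LipschitzWith C.toNNReal g ∧ ∀ t, g t ∈ K}
  have himg : ContinuousMap.toFun '' S =
      {h : ℝ → E | LipschitzWith C.toNNReal h} ∩ Set.pi Set.univ (fun _ => K) := by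
    ext h
    constructor
    · rintro ⟨g, hg, rfl⟩
      exact ⟨hg.1, fun t _ => hg.2 t⟩
    · rintro ⟨h1, h2⟩
      exact ⟨⟨h, h1.continuous⟩, ⟨h1, fun t => h2 t trivial⟩, rfl⟩
  have hclosed : IsClosed {h : ℝ → E | LipschitzWith C.toNNReal h} := by
    simp only [lipschitzWith_iff_dist_le_mul, Set.ofPred_forall]
    refine isClosed_iInter fun x => isClosed_iInter fun y => ?_
    exact isClosed_le ((continuous_apply x).dist (continuous_apply y)) continuous_const
  have hS : IsCompact S := by
    apply ArzelaAscoli.isCompact_of_equicontinuous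
    · rw [himg]
      exact (isCompact_univ_pi fun _ => hK).inter_left hclosed
    · exact (LipschitzWith.uniformEquicontinuous _ C.toNNReal
        (fun g : S => g.2.1)).equicontinuous
  let G : ℕ → C(ℝ, E) := fun n => ⟨γseq n, (hLip n).continuous⟩
  have hG : ∀ n, G n ∈ S := fun n => ⟨hLip n, hmem n⟩
  obtain ⟨g, hgS, φ, hφ, hlim⟩ := hS.tendsto_subseq hG
  refine ⟨φ, hφ, g, ?_, hgS.2, ?_⟩
  · intro t
    let N : C(E, E) := ⟨fun x => -(gradient f x), hgrad.neg⟩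
    have h1 := ((ContinuousMap.continuous_postcomp (X := ℝ) N).tendsto g).comp hlim
    have h2 := ContinuousMap.tendsto_iff_tendstoLocallyUniformly.mp h1
    refine hasDerivAt_of_tendstoLocallyUniformlyOn (f := fun n => γseq (φ n)) (l := atTop)
      (g' := fun t => -(gradient f (g t)))
      (f' := fun n t => -(gradient f (γseq (φ n) t))) isOpen_univ
      (tendstoLocallyUniformlyOn_univ.mpr h2) (Eventually.of_forall fun n x _ => hγseq (φ n) x)
      (fun x _ => ?_) (Set.mem_univ t)
    exact ((continuous_eval_const (F := C(ℝ, E)) x).tendsto g).comp hlim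
  · intro T hT
    exact ContinuousMap.tendsto_iff_forall_isCompact_tendstoUniformlyOn.mp hlim T hT
end

section
/- Let W₀ ⊆ ℝⁿ be a linear subspace, a ≤ b real numbers, and let u = (q, p) : [a,b] × [0,1] → ℝⁿ × ℝⁿ be twice continuously differentiable. Suppose p(s, 0) = 0, q(s, 1) ∈ W₀ and p(s, 1) ∈ W₀^⊥ for all s ∈ [a,b]. Then ∫_a^b ∫₀¹ ( ⟨∂_s p, ∂_t q⟩ − ⟨∂_t p, ∂_s q⟩ ) dt ds = ∫₀¹ ⟨p(b,t), ∂_t q(b,t)⟩ dt − ∫₀¹ ⟨p(a,t), ∂_t q(a,t)⟩ dt. (This is Stokes' theorem for the pullback of ω = dλ under a map of a rectangle whose horizontal boundaries lie on the zero section and on the conormal ν*W₀.) -/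
open intervalIntegral
open scoped RealInnerProductSpace

/-- Stokes' theorem for the pullback of `ω = dλ` under a `C²` map
`u = (q, p)` of the rectangle `[a,b] × [0,1]` into `ℝⁿ × ℝⁿ` whose boundary at
`t = 0` lies on the zero section and at `t = 1` on the conormal `W₀ × W₀^⊥`:
`∫_a^b ∫₀¹ (⟪∂ₛp, ∂ₜq⟫ - ⟪∂ₜp, ∂ₛq⟫) dt ds
  = ∫₀¹ ⟪p(b,t), ∂ₜq(b,t)⟫ dt - ∫₀¹ ⟪p(a,t), ∂ₜq(a,t)⟫ dt`. -/
theorem stokes_rectangle_conormal (n : ℕ)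
    (W₀ : Submodule ℝ (EuclideanSpace ℝ (Fin n)))
    (a b : ℝ) (hab : a ≤ b)
    (u : ℝ × ℝ → EuclideanSpace ℝ (Fin n) × EuclideanSpace ℝ (Fin n))
    (hu : ContDiff ℝ 2 u)
    (hzero : ∀ s ∈ Set.Icc a b, (u (s, 0)).2 = 0)
    (hconormal : ∀ s ∈ Set.Icc a b, (u (s, 1)).1 ∈ W₀ ∧ (u (s, 1)).2 ∈ W₀ᗮ) :
    (∫ s in a..b, ∫ t in (0:ℝ)..1,
        (⟪deriv (fun s' => (u (s', t)).2) s, deriv (fun t' => (u (s, t')).1) t⟫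
          - ⟪deriv (fun t' => (u (s, t')).2) t, deriv (fun s' => (u (s', t)).1) s⟫))
      = (∫ t in (0:ℝ)..1, ⟪(u (b, t)).2, deriv (fun t' => (u (b, t')).1) t⟫)
        - ∫ t in (0:ℝ)..1, ⟪(u (a, t)).2, deriv (fun t' => (u (a, t')).1) t⟫ := by
  obtain ⟨q, hq⟩ : ∃ q : ℝ × ℝ → EuclideanSpace ℝ (Fin n), q = fun x => (u x).1 := ⟨_, rfl⟩
  obtain ⟨p, hp⟩ : ∃ p : ℝ × ℝ → EuclideanSpace ℝ (Fin n), p = fun x => (u x).2 := ⟨_, rfl⟩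
  have hqc : ContDiff ℝ 2 q := hq ▸ contDiff_fst.comp hu
  have hpc : ContDiff ℝ 2 p := hp ▸ contDiff_snd.comp hu
  have e1 : ∀ x, (u x).1 = q x := fun x => by rw [hq]
  have e2 : ∀ x, (u x).2 = p x := fun x => by rw [hp]
  simp only [e1, e2] at hzero hconormal ⊢
  clear e1 e2 hq hp hu
  have ds : ∀ r : ℝ × ℝ → EuclideanSpace ℝ (Fin n), ContDiff ℝ 2 r → ∀ s t,
      HasDerivAt (fun s' => r (s', t)) (fderiv ℝ r (s, t) (1, 0)) s := by
    intro r hr s t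
    have h := (hr.differentiable (by norm_num) (s, t)).hasFDerivAt
    exact h.comp_hasDerivAt s ((hasDerivAt_id s).prodMk (hasDerivAt_const s t))
  have dt : ∀ r : ℝ × ℝ → EuclideanSpace ℝ (Fin n), ContDiff ℝ 2 r → ∀ s t,
      HasDerivAt (fun t' => r (s, t')) (fderiv ℝ r (s, t) (0, 1)) t := by
    intro r hr s t
    have h := (hr.differentiable (by norm_num) (s, t)).hasFDerivAt
    exact h.comp_hasDerivAt t ((hasDerivAt_const t s).prodMk (hasDerivAt_id t))
  simp only [fun s t => (ds q hqc s t).deriv, fun s t => (ds p hpc s t).deriv,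
    fun s t => (dt q hqc s t).deriv, fun s t => (dt p hpc s t).deriv]
  have hdq : ContDiff ℝ 1 (fderiv ℝ q) := hqc.fderiv_right (by norm_num)
  have hdp : ContDiff ℝ 1 (fderiv ℝ p) := hpc.fderiv_right (by norm_num)
  have hv : ∀ v : ℝ × ℝ, ContDiff ℝ 1 (fun x => ⟪p x, fderiv ℝ q x v⟫) := fun v =>
    (hpc.of_le (by norm_num)).inner ℝ (hdq.clm_apply contDiff_const)
  have hvd : ∀ (v : ℝ × ℝ) x w, fderiv ℝ (fun x => ⟪p x, fderiv ℝ q x v⟫) x w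
      = ⟪p x, fderiv ℝ (fderiv ℝ q) x w v⟫ + ⟪fderiv ℝ p x w, fderiv ℝ q x v⟫ := by
    intro v x w
    have h1 := hpc.differentiable (by norm_num) x
    have h2 := hdq.differentiable (by norm_num) x
    have h3 : HasFDerivAt (fun x => fderiv ℝ q x v) ((fderiv ℝ (fderiv ℝ q) x).flip v) x := by
      simpa using h2.hasFDerivAt.clm_apply (hasFDerivAt_const v x)
    rw [fderiv_inner_apply ℝ h1 h3.differentiableAt, h3.fderiv]
    rfl
  have hf := hv (0, 1)
  have hg := (hv (1, 0)).neg
  have key : ∀ x, fderiv ℝ (fun x => ⟪p x, fderiv ℝ q x (0, 1)⟫) x (1, 0)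
      + fderiv ℝ (fun x => -⟪p x, fderiv ℝ q x (1, 0)⟫) x (0, 1)
      = ⟪fderiv ℝ p x (1, 0), fderiv ℝ q x (0, 1)⟫
        - ⟪fderiv ℝ p x (0, 1), fderiv ℝ q x (1, 0)⟫ := by
    intro x
    have hs : IsSymmSndFDerivAt ℝ q x := hqc.contDiffAt.isSymmSndFDerivAt (by simp)
    rw [fderiv_fun_neg, ContinuousLinearMap.neg_apply, hvd, hvd, hs.eq (1, 0) (0, 1)]
    ring
  have D := MeasureTheory.integral2_divergence_prod_of_hasFDerivAt
    (fun x => ⟪p x, fderiv ℝ q x (0, 1)⟫) (fun x => -⟪p x, fderiv ℝ q x (1, 0)⟫)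
    (fderiv ℝ (fun x => ⟪p x, fderiv ℝ q x (0, 1)⟫))
    (fderiv ℝ (fun x => -⟪p x, fderiv ℝ q x (1, 0)⟫)) a 0 b 1
    hf.continuous.continuousOn hg.continuous.continuousOn
    (fun x _ => (hf.differentiable (by norm_num) x).hasFDerivAt)
    (fun x _ => (hg.differentiable (by norm_num) x).hasFDerivAt)
    (by
      refine ContinuousOn.integrableOn_compact (isCompact_uIcc.prod isCompact_uIcc) ?_
      exact (((hf.continuous_fderiv (by norm_num)).clm_apply continuous_const).add
        ((hg.continuous_fderiv (by norm_num)).clm_apply continuous_const)).continuousOn)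
  simp only [key] at D
  have h0 : ∫ s in a..b, -⟪p (s, 0), fderiv ℝ q (s, 0) (1, 0)⟫ = 0 := by
    rw [intervalIntegral.integral_congr (g := fun _ => (0 : ℝ))]
    · simp
    · intro s hs
      rw [Set.uIcc_of_le hab] at hs
      simp [hzero s hs]
  have h1 : ∫ s in a..b, -⟪p (s, 1), fderiv ℝ q (s, 1) (1, 0)⟫ = 0 := by
    rw [intervalIntegral.integral_of_le hab, MeasureTheory.integral_Ioc_eq_integral_Ioo]
    refine MeasureTheory.setIntegral_eq_zero_of_forall_eq_zero ?_
    intro s hs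
    have hd := (hasDerivAt_const s (p (s, 1))).inner ℝ (ds q hqc s 1)
    have he : (fun s' => ⟪p (s, 1), q (s', 1)⟫) =ᶠ[nhds s] fun _ => (0 : ℝ) := by
      filter_upwards [Icc_mem_nhds hs.1 hs.2] with s' hs'
      exact Submodule.inner_left_of_mem_orthogonal (hconormal s' hs').1
        (hconormal s (Set.Ioo_subset_Icc_self hs)).2
    have := hd.unique ((hasDerivAt_const s (0 : ℝ)).congr_of_eventuallyEq he)
    simpa using this
  rw [h0, h1] at D
  simpa using D
end

section
/- Let W₀ ⊆ ℝⁿ be a linear subspace and let u = q + i p : ℝ × [0,1] → ℂⁿ be a bounded, twice continuously differentiable map satisfying the Cauchy–Riemann equation ∂_s u = i ∂_t u on the strip, with boundary conditions p(s, 0) = 0, q(s, 1) ∈ W₀ and p(s, 1) ∈ W₀^⊥ for all s ∈ ℝ. If sup_{t ∈ [0,1]} ‖∂_t u(s,t)‖ → 0 as s → +∞ and as s → −∞, then u is constant. (Flat-model statement that every finite-energy holomorphic strip with one boundary on the zero section and the other on a conormal bundle is constant.) -/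
open Filter
open scoped RealInnerProductSpace Topology

/-- Vanishing of the energy density, in terms of the two components. -/
theorem strip_energy_zero {E : Type*} [NormedAddCommGroup E] [InnerProductSpace ℝ E]
    (q p : ℝ × ℝ → E) (hq : ContDiff ℝ 2 q) (hp : ContDiff ℝ 2 p) (C : ℝ)
    (hC : ∀ s : ℝ, ∀ t ∈ Set.Icc (0:ℝ) 1, ‖p (s, t)‖ ≤ C)
    (h1 : ∀ s : ℝ, ∀ t ∈ Set.Icc (0:ℝ) 1,
      fderiv ℝ q (s, t) (1, 0) = -fderiv ℝ p (s, t) (0, 1))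
    (h2 : ∀ s : ℝ, ∀ t ∈ Set.Icc (0:ℝ) 1,
      fderiv ℝ p (s, t) (1, 0) = fderiv ℝ q (s, t) (0, 1))
    (hz : ∀ s : ℝ, p (s, 0) = 0)
    (hc : ∀ s s' : ℝ, ⟪p (s, 1), q (s', 1)⟫ = 0)
    (hd : ∀ ε > (0:ℝ), ∃ S : ℝ, ∀ s : ℝ, S ≤ |s| →
      ∀ t ∈ Set.Icc (0:ℝ) 1, ‖fderiv ℝ q (s, t) (0, 1)‖ ≤ ε) :
    ∀ s : ℝ, ∀ t ∈ Set.Icc (0:ℝ) 1,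
      fderiv ℝ q (s, t) (0, 1) = 0 ∧ fderiv ℝ p (s, t) (0, 1) = 0 := by
  have hqd : ContDiff ℝ 1 (fderiv ℝ q) := hq.fderiv_right (by norm_num)
  have hpd : ContDiff ℝ 1 (fderiv ℝ p) := hp.fderiv_right (by norm_num)
  have hp1 : ContDiff ℝ 1 p := hp.of_le (by norm_num)
  have hq1 : ContDiff ℝ 1 q := hq.of_le (by norm_num)
  have hdir : ∀ v : ℝ × ℝ, ContDiff ℝ 1 (fun x => ⟪p x, fderiv ℝ q x v⟫) := fun v =>
    hp1.inner ℝ (hqd.clm_apply contDiff_const)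
  have hder : ∀ v w x, fderiv ℝ (fun x => ⟪p x, fderiv ℝ q x v⟫) x w =
      ⟪p x, fderiv ℝ (fderiv ℝ q) x w v⟫ + ⟪fderiv ℝ p x w, fderiv ℝ q x v⟫ := by
    intro v w x
    have a := (hp1.differentiable (by norm_num) x).hasFDerivAt
    have b := (hqd.differentiable (by norm_num) x).hasFDerivAt
    have b' := b.clm_apply (hasFDerivAt_const v x)
    rw [(a.inner ℝ b').fderiv]
    simp [fderivInnerCLM_apply]
  let e : ℝ × ℝ → ℝ := fun x => ‖fderiv ℝ q x (0, 1)‖ ^ 2 + ‖fderiv ℝ p x (0, 1)‖ ^ 2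
  have he : Continuous e := by
    have a := hqd.continuous
    have b := hpd.continuous
    fun_prop
  have he0 : ∀ x, 0 ≤ e x := fun x => by positivity
  have heq : ∀ s : ℝ, ∀ t ∈ Set.Icc (0:ℝ) 1,
      fderiv ℝ (fun x => ⟪p x, fderiv ℝ q x (0, 1)⟫) (s, t) (1, 0) +
      (-fderiv ℝ (fun x => ⟪p x, fderiv ℝ q x (1, 0)⟫) (s, t)) (0, 1) = e (s, t) := by
    intro s t ht
    have hsym : IsSymmSndFDerivAt ℝ q (s, t) := hq.contDiffAt.isSymmSndFDerivAt (by simp)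
    rw [neg_apply, hder, hder, hsym (1, 0) (0, 1), h1 s t ht, h2 s t ht]
    simp only [e, inner_neg_right, real_inner_self_eq_norm_sq]
    ring
  have hb1 : ∀ s : ℝ, ⟪p (s, 1), fderiv ℝ q (s, 1) (1, 0)⟫ = 0 := by
    intro s
    have a := (hq1.differentiable (by norm_num) (s, 1)).hasFDerivAt
    have l : HasDerivAt (fun s' : ℝ => (s', (1:ℝ))) ((1:ℝ), (0:ℝ)) s :=
      (hasDerivAt_id s).prodMk (hasDerivAt_const s 1)
    have b := a.comp_hasDerivAt s l
    have c := (hasDerivAt_const s (p (s, 1))).inner ℝ b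
    have d : (fun s' : ℝ => ⟪p (s, 1), (q ∘ fun s' : ℝ => (s', (1:ℝ))) s'⟫) = fun _ => 0 := by
      funext s'; exact hc s s'
    rw [d] at c
    simpa using c.unique (hasDerivAt_const s (0:ℝ))
  let φ : ℝ → ℝ := fun s => ∫ t in (0:ℝ)..1, e (s, t)
  have hφ : Continuous φ :=
    intervalIntegral.continuous_parametric_intervalIntegral_of_continuous' (f := fun s t => e (s, t))
      (by simpa [Function.uncurry_def] using he) 0 1
  have hφ0 : ∀ s, 0 ≤ φ s := fun s =>
    intervalIntegral.integral_nonneg zero_le_one fun t _ => he0 _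
  have key : ∀ a b : ℝ, ∫ s in a..b, φ s =
      (∫ t in (0:ℝ)..1, ⟪p (b, t), fderiv ℝ q (b, t) (0, 1)⟫) -
        ∫ t in (0:ℝ)..1, ⟪p (a, t), fderiv ℝ q (a, t) (0, 1)⟫ := by
    intro a b
    have hG := hdir (0, 1)
    have hH := hdir (1, 0)
    have D := MeasureTheory.integral2_divergence_prod_of_hasFDerivAt_off_countable
      (fun x => ⟪p x, fderiv ℝ q x (0, 1)⟫) (fun x => -⟪p x, fderiv ℝ q x (1, 0)⟫)
      (fderiv ℝ (fun x => ⟪p x, fderiv ℝ q x (0, 1)⟫))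
      (fun x => -fderiv ℝ (fun x => ⟪p x, fderiv ℝ q x (1, 0)⟫) x) a 0 b 1 ∅
      Set.countable_empty hG.continuous.continuousOn hH.continuous.neg.continuousOn
      (fun x _ => (hG.differentiable (by norm_num) x).hasFDerivAt)
      (fun x _ => (hH.differentiable (by norm_num) x).hasFDerivAt.neg)
      (by
        refine ContinuousOn.integrableOn_compact (isCompact_uIcc.prod isCompact_uIcc) ?_
        have c1 := hG.continuous_fderiv (by norm_num)
        have c2 := hH.continuous_fderiv (by norm_num)
        exact ((c1.clm_apply continuous_const).add
          (c2.neg.clm_apply continuous_const)).continuousOn)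
    have L : ∀ s : ℝ, (∫ t in (0:ℝ)..1,
        fderiv ℝ (fun x => ⟪p x, fderiv ℝ q x (0, 1)⟫) (s, t) (1, 0) +
        (-fderiv ℝ (fun x => ⟪p x, fderiv ℝ q x (1, 0)⟫) (s, t)) (0, 1)) = φ s := by
      intro s
      refine intervalIntegral.integral_congr fun t ht => ?_
      rw [Set.uIcc_of_le zero_le_one] at ht
      exact heq s t ht
    simp only [L] at D
    rw [D]
    simp [hb1, hz]
  have bound : ∀ ε > (0:ℝ), ∃ S : ℝ, ∀ s : ℝ, S ≤ |s| →
      |∫ t in (0:ℝ)..1, ⟪p (s, t), fderiv ℝ q (s, t) (0, 1)⟫| ≤ C * ε := by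
    intro ε hε
    obtain ⟨S, hS⟩ := hd ε hε
    refine ⟨S, fun s hs => ?_⟩
    have := intervalIntegral.norm_integral_le_of_norm_le_const (a := 0) (b := 1) (C := C * ε)
      (f := fun t => ⟪p (s, t), fderiv ℝ q (s, t) (0, 1)⟫) (by
        intro t ht
        rw [Set.uIoc_of_le zero_le_one] at ht
        have ht' : t ∈ Set.Icc (0:ℝ) 1 := ⟨ht.1.le, ht.2⟩
        refine (norm_inner_le_norm _ _).trans ?_
        exact mul_le_mul (hC s t ht') (hS s hs t ht') (norm_nonneg _)
          ((norm_nonneg _).trans (hC s t ht')))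
    simpa using this
  have hC0 : 0 ≤ C := (norm_nonneg _).trans (hC 0 0 (by simp))
  intro s t ht
  have hes : e (s, t) = 0 := by
    by_contra hne
    have hpos : 0 < e (s, t) := lt_of_le_of_ne (he0 _) (Ne.symm hne)
    have hφs : 0 < φ s :=
      intervalIntegral.integral_pos zero_lt_one (by fun_prop) (fun x _ => he0 _) ⟨t, ht, hpos⟩
    have hδ : 0 < ∫ x in (s - 1)..(s + 1), φ x :=
      intervalIntegral.integral_pos (by linarith) hφ.continuousOn (fun x _ => hφ0 _)
        ⟨s, ⟨by linarith, by linarith⟩, hφs⟩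
    set δ := ∫ x in (s - 1)..(s + 1), φ x with hδdef
    obtain ⟨S, hS⟩ := bound (δ / (4 * (C + 1))) (by positivity)
    let R := |S| + |s| + 1
    have hR : 0 ≤ R := by positivity
    have hSR : S ≤ R := by
      have := le_abs_self S; have := abs_nonneg s; simp only [R]; linarith
    have m : δ ≤ ∫ x in (-R)..R, φ x := by
      have := le_abs_self s; have := neg_abs_le s; have := abs_nonneg S
      refine intervalIntegral.integral_mono_interval ?_ ?_ ?_
        (Filter.Eventually.of_forall hφ0) (hφ.intervalIntegrable _ _) <;>
        (try simp only [R]) <;> linarith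
    rw [key] at m
    have b1 := hS R (by rwa [abs_of_nonneg hR])
    have b2 := hS (-R) (by rwa [abs_neg, abs_of_nonneg hR])
    have b3 : C * (δ / (4 * (C + 1))) ≤ δ / 4 := by
      rw [mul_div_assoc', div_le_div_iff₀ (by positivity) (by positivity)]
      nlinarith
    have := (abs_le.1 b1).2
    have := (abs_le.1 b2).1
    linarith
  have x1 := sq_nonneg ‖fderiv ℝ q (s, t) (0, 1)‖
  have x2 := sq_nonneg ‖fderiv ℝ p (s, t) (0, 1)‖
  simp only [e] at hes
  constructor
  · have : ‖fderiv ℝ q (s, t) (0, 1)‖ ^ 2 = 0 := by linarith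
    simpa using this
  · have : ‖fderiv ℝ p (s, t) (0, 1)‖ ^ 2 = 0 := by linarith
    simpa using this

/-- Every bounded finite-energy holomorphic strip with one boundary on the zero
section and the other on a conormal bundle is constant (flat model): if
`u = (q, p) : ℝ × [0,1] → ℝⁿ × ℝⁿ ≅ ℂⁿ` is bounded, `C²`, satisfies the
Cauchy–Riemann equation `∂ₛu = i ∂ₜu` (i.e. `∂ₛq = -∂ₜp`, `∂ₛp = ∂ₜq`) on the strip,
with `p(s,0) = 0`, `q(s,1) ∈ W₀`, `p(s,1) ∈ W₀^⊥`, and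
`sup_{t ∈ [0,1]} ‖∂ₜu(s,t)‖ → 0` as `s → ±∞`, then `u` is constant on the strip. -/
theorem holomorphic_strip_constant (n : ℕ)
    (W₀ : Submodule ℝ (EuclideanSpace ℝ (Fin n)))
    (u : ℝ × ℝ → EuclideanSpace ℝ (Fin n) × EuclideanSpace ℝ (Fin n))
    (hu : ContDiff ℝ 2 u)
    (hbdd : ∃ C : ℝ, ∀ s : ℝ, ∀ t ∈ Set.Icc (0:ℝ) 1, ‖u (s, t)‖ ≤ C)
    (hCR : ∀ s : ℝ, ∀ t ∈ Set.Icc (0:ℝ) 1,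
      deriv (fun s' => (u (s', t)).1) s = -(deriv (fun t' => (u (s, t')).2) t) ∧
      deriv (fun s' => (u (s', t)).2) s = deriv (fun t' => (u (s, t')).1) t)
    (hzero : ∀ s : ℝ, (u (s, 0)).2 = 0)
    (hconormal : ∀ s : ℝ, (u (s, 1)).1 ∈ W₀ ∧ (u (s, 1)).2 ∈ W₀ᗮ)
    (hdecay : ∀ ε > (0:ℝ), ∃ S : ℝ, ∀ s : ℝ, S ≤ |s| →
      ∀ t ∈ Set.Icc (0:ℝ) 1, ‖deriv (fun t' => u (s, t')) t‖ ≤ ε) :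
    ∀ s s' : ℝ, ∀ t ∈ Set.Icc (0:ℝ) 1, ∀ t' ∈ Set.Icc (0:ℝ) 1,
      u (s, t) = u (s', t') := by
  obtain ⟨C, hC⟩ := hbdd
  have hq : ContDiff ℝ 2 (fun x => (u x).1) := hu.fst
  have hp : ContDiff ℝ 2 (fun x => (u x).2) := hu.snd
  have lt : ∀ {F : Type} [NormedAddCommGroup F] [NormedSpace ℝ F] (f : ℝ × ℝ → F),
      ContDiff ℝ 2 f → ∀ s t : ℝ,
      HasDerivAt (fun t' => f (s, t')) (fderiv ℝ f (s, t) (0, 1)) t := by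
    intro F _ _ f hf s t
    have a := (hf.differentiable (by norm_num) (s, t)).hasFDerivAt
    exact a.comp_hasDerivAt t ((hasDerivAt_const t s).prodMk (hasDerivAt_id t))
  have ls : ∀ {F : Type} [NormedAddCommGroup F] [NormedSpace ℝ F] (f : ℝ × ℝ → F),
      ContDiff ℝ 2 f → ∀ s t : ℝ,
      HasDerivAt (fun s' => f (s', t)) (fderiv ℝ f (s, t) (1, 0)) s := by
    intro F _ _ f hf s t
    have a := (hf.differentiable (by norm_num) (s, t)).hasFDerivAt
    exact a.comp_hasDerivAt s ((hasDerivAt_id s).prodMk (hasDerivAt_const s t))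
  have h1 : ∀ s : ℝ, ∀ t ∈ Set.Icc (0:ℝ) 1,
      fderiv ℝ (fun x => (u x).1) (s, t) (1, 0) = -fderiv ℝ (fun x => (u x).2) (s, t) (0, 1) := by
    intro s t ht
    have := (hCR s t ht).1
    rwa [(ls _ hq s t).deriv, (lt _ hp s t).deriv] at this
  have h2 : ∀ s : ℝ, ∀ t ∈ Set.Icc (0:ℝ) 1,
      fderiv ℝ (fun x => (u x).2) (s, t) (1, 0) = fderiv ℝ (fun x => (u x).1) (s, t) (0, 1) := by
    intro s t ht
    have := (hCR s t ht).2
    rwa [(ls _ hp s t).deriv, (lt _ hq s t).deriv] at this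
  have hu1 : Differentiable ℝ u := hu.differentiable (by norm_num)
  have hfst : ∀ x v, fderiv ℝ (fun x => (u x).1) x v = (fderiv ℝ u x v).1 := by
    intro x v
    rw [(hu1 x).hasFDerivAt.fst.fderiv]; rfl
  have hsnd : ∀ x v, fderiv ℝ (fun x => (u x).2) x v = (fderiv ℝ u x v).2 := by
    intro x v
    rw [(hu1 x).hasFDerivAt.snd.fderiv]; rfl
  have key := strip_energy_zero (fun x => (u x).1) (fun x => (u x).2) hq hp C
    (fun s t ht => (norm_snd_le _).trans (hC s t ht)) h1 h2 hzero
    (fun s s' => Submodule.inner_left_of_mem_orthogonal (hconormal s').1 (hconormal s).2)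
    (by
      intro ε hε
      obtain ⟨S, hS⟩ := hdecay ε hε
      refine ⟨S, fun s hs t ht => ?_⟩
      have := hS s hs t ht
      rw [(lt u hu s t).deriv] at this
      rw [hfst]
      exact (norm_fst_le _).trans this)
  have hzero' : ∀ x ∈ (Set.univ ×ˢ Set.Icc (0:ℝ) 1 : Set (ℝ × ℝ)), fderiv ℝ u x = 0 := by
    rintro ⟨s, t⟩ ⟨-, ht⟩
    obtain ⟨k1, k2⟩ := key s t ht
    have k3 := h1 s t ht
    have k4 := h2 s t ht
    rw [k2, neg_zero] at k3
    rw [k1] at k4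
    rw [hfst] at k1 k3
    rw [hsnd] at k2 k4
    refine ContinuousLinearMap.ext fun v => ?_
    have hv : v = v.1 • ((1:ℝ), (0:ℝ)) + v.2 • ((0:ℝ), (1:ℝ)) := by ext <;> simp
    rw [hv, map_add, map_smul, map_smul]
    ext1 <;> simp [k1, k2, k3, k4]
  intro s s' t ht t' ht'
  have := (convex_univ.prod (convex_Icc (0:ℝ) 1)).norm_image_sub_le_of_norm_fderiv_le
    (𝕜 := ℝ) (f := u) (C := 0) (x := (s', t')) (y := (s, t)) (fun x _ => hu1 x)
    (fun x hx => by rw [hzero' x hx, norm_zero]) ⟨trivial, ht'⟩ ⟨trivial, ht⟩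
  rw [zero_mul] at this
  exact sub_eq_zero.1 (norm_le_zero_iff.1 this)
end

section
/- Let W₀ ⊆ ℝⁿ be a linear subspace, H : (ℝⁿ × ℝⁿ) × [0,1] → ℝ continuously differentiable, and let u = (q, p) : [a,b] × [0,1] → ℝⁿ × ℝⁿ be twice continuously differentiable and satisfy the Floer equation ∂_s q = −∂_t p − ∇_q H(u, t), ∂_s p = ∂_t q − ∇_p H(u, t), together with the boundary conditions p(s, 0) = 0, q(s, 1) ∈ W₀, p(s, 1) ∈ W₀^⊥ for all s ∈ [a,b]. Then the action functional decreases along u, with exact energy loss: 𝒜_H(u(b,·)) − 𝒜_H(u(a,·)) = −∫_a^b ∫₀¹ ( ‖∂_s q‖² + ‖∂_s p‖² ) dt ds. -/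
open intervalIntegral
open scoped RealInnerProductSpace

/-- The action functional `𝒜_H(γ) = -∫₀¹ ⟪p_γ(t), q_γ'(t)⟫ dt + ∫₀¹ H(γ(t), t) dt`
of a path `γ = (q_γ, p_γ) : [0,1] → ℝⁿ × ℝⁿ`. -/
noncomputable def actionFunctional {n : ℕ}
    (H : (EuclideanSpace ℝ (Fin n) × EuclideanSpace ℝ (Fin n)) × ℝ → ℝ)
    (γ : ℝ → EuclideanSpace ℝ (Fin n) × EuclideanSpace ℝ (Fin n)) : ℝ :=
  -(∫ t in (0:ℝ)..1, ⟪(γ t).2, deriv (fun τ => (γ τ).1) t⟫)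
    + ∫ t in (0:ℝ)..1, H (γ t, t)

theorem floer_hasDerivAt_fst {F : Type*} [NormedAddCommGroup F] [NormedSpace ℝ F]
    {f : ℝ × ℝ → F} (hf : Differentiable ℝ f) (s t : ℝ) :
    HasDerivAt (fun s' => f (s', t)) (fderiv ℝ f (s, t) (1, 0)) s := by
  have h1 : HasDerivAt (fun s' : ℝ => (s', t)) ((1 : ℝ), (0 : ℝ)) s :=
    (hasDerivAt_id s).prodMk (hasDerivAt_const s t)
  exact (hf (s, t)).hasFDerivAt.comp_hasDerivAt s h1

theorem floer_hasDerivAt_snd {F : Type*} [NormedAddCommGroup F] [NormedSpace ℝ F]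
    {f : ℝ × ℝ → F} (hf : Differentiable ℝ f) (s t : ℝ) :
    HasDerivAt (fun t' => f (s, t')) (fderiv ℝ f (s, t) (0, 1)) t := by
  have h1 : HasDerivAt (fun t' : ℝ => (s, t')) ((0 : ℝ), (1 : ℝ)) t :=
    (hasDerivAt_const t s).prodMk (hasDerivAt_id t)
  exact (hf (s, t)).hasFDerivAt.comp_hasDerivAt t h1

theorem floer_symm {F : Type*} [NormedAddCommGroup F] [NormedSpace ℝ F]
    {f : ℝ × ℝ → F} (hf : ContDiff ℝ 2 f) (x v w : ℝ × ℝ) :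
    fderiv ℝ (fun y => fderiv ℝ f y v) x w = fderiv ℝ (fun y => fderiv ℝ f y w) x v := by
  have hd : DifferentiableAt ℝ (fderiv ℝ f) x :=
    ((hf.fderiv_right (m := 1) (by norm_num)).differentiable (by norm_num)) x
  have key : ∀ v w : ℝ × ℝ,
      fderiv ℝ (fun y => fderiv ℝ f y v) x w = fderiv ℝ (fderiv ℝ f) x w v := by
    intro v w
    have := (hd.hasFDerivAt.clm_apply (hasFDerivAt_const v x)).fderiv
    rw [this]; simp
  rw [key, key]
  exact (hf.contDiffAt.isSymmSndFDerivAt (by simp)) w v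

theorem floer_ii {G : ℝ × ℝ → ℝ} (hG : Continuous G) (s c d : ℝ) :
    IntervalIntegrable (fun t => G (s, t)) MeasureTheory.volume c d :=
  (hG.comp (by fun_prop : Continuous fun t : ℝ => (s, t))).intervalIntegrable _ _

theorem floer_grad {E : Type*} [NormedAddCommGroup E] [InnerProductSpace ℝ E] [CompleteSpace E]
    {H : (E × E) × ℝ → ℝ} (hH : Differentiable ℝ H) (q p v w : E) (t : ℝ) :
    fderiv ℝ H ((q, p), t) ((v, w), 0)
      = ⟪gradient (fun q' => H ((q', p), t)) q, v⟫
        + ⟪gradient (fun p' => H ((q, p'), t)) p, w⟫ := by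
  have h := (hH ((q, p), t)).hasFDerivAt
  have h1 : HasFDerivAt (fun q' => H ((q', p), t)) _ q :=
    h.comp q (((hasFDerivAt_id q).prodMk (hasFDerivAt_const p q)).prodMk (hasFDerivAt_const t q))
  have h2 : HasFDerivAt (fun p' => H ((q, p'), t)) _ p :=
    h.comp p (((hasFDerivAt_const q p).prodMk (hasFDerivAt_id p)).prodMk (hasFDerivAt_const t p))
  rw [gradient, gradient, InnerProductSpace.toDual_symm_apply,
    InnerProductSpace.toDual_symm_apply, h1.fderiv, h2.fderiv]
  simp [← map_add]

/-- The action functional decreases along solutions of the Floer equation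
`∂ₛq = -∂ₜp - ∇_q H(u,t)`, `∂ₛp = ∂ₜq - ∇_p H(u,t)` with boundary conditions
`p(s,0) = 0`, `q(s,1) ∈ W₀`, `p(s,1) ∈ W₀^⊥`, with exact energy loss:
`𝒜_H(u(b,·)) - 𝒜_H(u(a,·)) = -∫_a^b ∫₀¹ (‖∂ₛq‖² + ‖∂ₛp‖²) dt ds`. -/
theorem action_decreases_along_Floer_strip (n : ℕ)
    (W₀ : Submodule ℝ (EuclideanSpace ℝ (Fin n)))
    (a b : ℝ) (hab : a ≤ b)
    (H : (EuclideanSpace ℝ (Fin n) × EuclideanSpace ℝ (Fin n)) × ℝ → ℝ)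
    (hH : ContDiff ℝ 1 H)
    (u : ℝ × ℝ → EuclideanSpace ℝ (Fin n) × EuclideanSpace ℝ (Fin n))
    (hu : ContDiff ℝ 2 u)
    (hFloer : ∀ s ∈ Set.Icc a b, ∀ t ∈ Set.Icc (0:ℝ) 1,
      deriv (fun s' => (u (s', t)).1) s
        = -(deriv (fun t' => (u (s, t')).2) t)
          - gradient (fun q => H ((q, (u (s, t)).2), t)) (u (s, t)).1 ∧
      deriv (fun s' => (u (s', t)).2) s
        = deriv (fun t' => (u (s, t')).1) t
          - gradient (fun p => H (((u (s, t)).1, p), t)) (u (s, t)).2)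
    (hzero : ∀ s ∈ Set.Icc a b, (u (s, 0)).2 = 0)
    (hconormal : ∀ s ∈ Set.Icc a b, (u (s, 1)).1 ∈ W₀ ∧ (u (s, 1)).2 ∈ W₀ᗮ) :
    actionFunctional H (fun t => u (b, t)) - actionFunctional H (fun t => u (a, t))
      = -∫ s in a..b, ∫ t in (0:ℝ)..1,
          (‖deriv (fun s' => (u (s', t)).1) s‖ ^ 2
            + ‖deriv (fun s' => (u (s', t)).2) s‖ ^ 2) := by
  have hHd : Differentiable ℝ H := hH.differentiable (by norm_num)
  obtain ⟨Q, hQ⟩ : ∃ Q : ℝ × ℝ → EuclideanSpace ℝ (Fin n), Q = fun x => (u x).1 := ⟨_, rfl⟩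
  obtain ⟨P, hP⟩ : ∃ P : ℝ × ℝ → EuclideanSpace ℝ (Fin n), P = fun x => (u x).2 := ⟨_, rfl⟩
  have hQ2 : ContDiff ℝ 2 Q := hQ ▸ hu.fst
  have hP2 : ContDiff ℝ 2 P := hP ▸ hu.snd
  have hu' : u = fun x => (Q x, P x) := by subst hQ hP; rfl
  clear hQ hP
  subst hu'
  have hQd : Differentiable ℝ Q := hQ2.differentiable (by norm_num)
  have hPd : Differentiable ℝ P := hP2.differentiable (by norm_num)
  have dQs : ∀ s t, deriv (fun s' => Q (s', t)) s = fderiv ℝ Q (s, t) (1, 0) :=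
    fun s t => (floer_hasDerivAt_fst hQd s t).deriv
  have dPs : ∀ s t, deriv (fun s' => P (s', t)) s = fderiv ℝ P (s, t) (1, 0) :=
    fun s t => (floer_hasDerivAt_fst hPd s t).deriv
  have dQt : ∀ s t, deriv (fun t' => Q (s, t')) t = fderiv ℝ Q (s, t) (0, 1) :=
    fun s t => (floer_hasDerivAt_snd hQd s t).deriv
  have dPt : ∀ s t, deriv (fun t' => P (s, t')) t = fderiv ℝ P (s, t) (0, 1) :=
    fun s t => (floer_hasDerivAt_snd hPd s t).deriv
  simp only [actionFunctional, dQs, dPs, dQt, dPt] at *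
  have hDQ : ∀ v, ContDiff ℝ 1 (fun x => fderiv ℝ Q x v) := fun v =>
    (hQ2.fderiv_right (m := 1) (by norm_num)).clm_apply contDiff_const
  have hDP : ∀ v, ContDiff ℝ 1 (fun x => fderiv ℝ P x v) := fun v =>
    (hP2.fderiv_right (m := 1) (by norm_num)).clm_apply contDiff_const
  have hP1 : ContDiff ℝ 1 P := hP2.of_le (by norm_num)
  have hQ1 : ContDiff ℝ 1 Q := hQ2.of_le (by norm_num)
  -- the Lagrangian density and the boundary density
  obtain ⟨A, hA⟩ : ∃ A : ℝ × ℝ → ℝ, A = fun x => ⟪P x, fderiv ℝ Q x (0, 1)⟫ := ⟨_, rfl⟩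
  obtain ⟨B, hB⟩ : ∃ B : ℝ × ℝ → ℝ, B = fun x => ⟪P x, fderiv ℝ Q x (1, 0)⟫ := ⟨_, rfl⟩
  obtain ⟨K, hK⟩ : ∃ K : ℝ × ℝ → ℝ, K = fun x => H ((Q x, P x), x.2) := ⟨_, rfl⟩
  have hA1 : ContDiff ℝ 1 A := hA ▸ hP1.inner ℝ (hDQ _)
  have hB1 : ContDiff ℝ 1 B := hB ▸ hP1.inner ℝ (hDQ _)
  have hK1 : ContDiff ℝ 1 K := hK ▸ hH.comp ((hQ1.prodMk hP1).prodMk contDiff_snd)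
  obtain ⟨F, hF⟩ : ∃ F : ℝ × ℝ → ℝ, F = fun x => - A x + K x := ⟨_, rfl⟩
  have hF1 : ContDiff ℝ 1 F := hF ▸ hA1.neg.add hK1
  have hFd : Differentiable ℝ F := hF1.differentiable (by norm_num)
  have hBd : Differentiable ℝ B := hB1.differentiable (by norm_num)
  have hact : ∀ s, -(∫ t in (0:ℝ)..1, ⟪P (s, t), fderiv ℝ Q (s, t) (0, 1)⟫)
      + ∫ t in (0:ℝ)..1, H ((Q (s, t), P (s, t)), t) = ∫ t in (0:ℝ)..1, F (s, t) := by
    intro s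
    have e := intervalIntegral.integral_add (floer_ii hA1.neg.continuous s 0 1)
      (floer_ii hK1.continuous s 0 1)
    rw [← intervalIntegral.integral_neg]
    subst hF hA hK
    exact e.symm
  -- pointwise identity
  have hpt : ∀ s ∈ Set.Icc a b, ∀ t ∈ Set.Icc (0:ℝ) 1,
      fderiv ℝ F (s, t) (1, 0) = -(‖fderiv ℝ Q (s, t) (1, 0)‖ ^ 2
        + ‖fderiv ℝ P (s, t) (1, 0)‖ ^ 2) - fderiv ℝ B (s, t) (0, 1) := by
    intro s hs t ht
    obtain ⟨f1, f2⟩ := hFloer s hs t ht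
    have hAs : HasDerivAt (fun s' => A (s', t)) (⟪P (s, t), fderiv ℝ (fun x => fderiv ℝ Q x (0, 1)) (s, t) (1, 0)⟫
        + ⟪fderiv ℝ P (s, t) (1, 0), fderiv ℝ Q (s, t) (0, 1)⟫) s := by
      rw [hA]
      exact (floer_hasDerivAt_fst hPd s t).inner ℝ
        (floer_hasDerivAt_fst ((hDQ (0, 1)).differentiable (by norm_num)) s t)
    have hBt : HasDerivAt (fun t' => B (s, t')) (⟪P (s, t), fderiv ℝ (fun x => fderiv ℝ Q x (1, 0)) (s, t) (0, 1)⟫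
        + ⟪fderiv ℝ P (s, t) (0, 1), fderiv ℝ Q (s, t) (1, 0)⟫) t := by
      rw [hB]
      exact (floer_hasDerivAt_snd hPd s t).inner ℝ
        (floer_hasDerivAt_snd ((hDQ (1, 0)).differentiable (by norm_num)) s t)
    have hKs : HasDerivAt (fun s' => K (s', t))
        (fderiv ℝ H ((Q (s, t), P (s, t)), t)
          ((fderiv ℝ Q (s, t) (1, 0), fderiv ℝ P (s, t) (1, 0)), 0)) s := by
      have h1 := (((floer_hasDerivAt_fst hQd s t).prodMk
        (floer_hasDerivAt_fst hPd s t)).prodMk (hasDerivAt_const s t))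
      have h2 := (hHd ((Q (s, t), P (s, t)), t)).hasFDerivAt.comp_hasDerivAt s h1
      rw [hK]; exact h2
    have hFs := hAs.neg.add hKs
    have hFe : ((-fun s' => A (s', t)) + fun s' => K (s', t)) = fun s' => F (s', t) := by
      rw [hF]; rfl
    rw [hFe] at hFs
    rw [(floer_hasDerivAt_fst hFd s t).unique hFs, (floer_hasDerivAt_snd hBd s t).unique hBt,
      floer_grad hHd, floer_symm hQ2 (s, t) (0, 1) (1, 0)]
    have g1 : gradient (fun q => H ((q, P (s, t)), t)) (Q (s, t))
        = -fderiv ℝ P (s, t) (0, 1) - fderiv ℝ Q (s, t) (1, 0) := by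
      rw [f1]; abel
    have g2 : gradient (fun p => H ((Q (s, t), p), t)) (P (s, t))
        = fderiv ℝ Q (s, t) (0, 1) - fderiv ℝ P (s, t) (1, 0) := by
      rw [f2]; abel
    rw [g1, g2]
    simp only [inner_sub_left, inner_neg_left, real_inner_self_eq_norm_sq]
    rw [real_inner_comm (fderiv ℝ Q (s, t) (0, 1)) (fderiv ℝ P (s, t) (1, 0))]
    ring
  have hcF : Continuous fun x => fderiv ℝ F x (1, 0) :=
    (hF1.continuous_fderiv (by norm_num)).clm_apply continuous_const
  have hcB : Continuous fun x => fderiv ℝ B x (0, 1) :=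
    (hB1.continuous_fderiv (by norm_num)).clm_apply continuous_const
  have hFTC : ∀ t, F (b, t) - F (a, t) = ∫ s in a..b, fderiv ℝ F (s, t) (1, 0) := by
    intro t
    refine (intervalIntegral.integral_eq_sub_of_hasDerivAt
      (fun s _ => floer_hasDerivAt_fst hFd s t) ?_).symm
    exact (hcF.comp (by fun_prop : Continuous fun s : ℝ => (s, t))).intervalIntegrable _ _
  rw [hact, hact, ← intervalIntegral.integral_sub
    (floer_ii hF1.continuous b 0 1) (floer_ii hF1.continuous a 0 1)]
  simp only [hFTC]
  have hswap : (∫ t in (0:ℝ)..1, ∫ s in a..b, fderiv ℝ F (s, t) (1, 0))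
      = ∫ s in a..b, ∫ t in (0:ℝ)..1, fderiv ℝ F (s, t) (1, 0) := by
    refine MeasureTheory.intervalIntegral_intervalIntegral_swap ?_
    have hc : Continuous (Function.uncurry fun t s : ℝ => fderiv ℝ F (s, t) (1, 0)) :=
      hcF.comp continuous_swap
    exact (hc.continuousOn.integrableOn_compact
      (isCompact_uIcc.prod isCompact_uIcc)).mono_set
      (Set.prod_mono Set.uIoc_subset_uIcc Set.uIoc_subset_uIcc)
  rw [hswap, ← intervalIntegral.integral_neg, intervalIntegral.integral_of_le hab,
    intervalIntegral.integral_of_le hab, MeasureTheory.integral_Ioc_eq_integral_Ioo,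
    MeasureTheory.integral_Ioc_eq_integral_Ioo]
  refine MeasureTheory.setIntegral_congr_fun measurableSet_Ioo ?_
  intro s hs
  have hs' : s ∈ Set.Icc a b := Set.Ioo_subset_Icc_self hs
  have hB0 : B (s, 0) = 0 := by
    rw [hB]; simp [hzero s hs']
  have hB1' : B (s, 1) = 0 := by
    have hd : HasDerivAt (fun s' => ⟪P (s, 1), Q (s', 1)⟫) _ s :=
      (hasDerivAt_const s (P (s, 1))).inner ℝ (floer_hasDerivAt_fst hQd s 1)
    have hz : HasDerivAt (fun s' => ⟪P (s, 1), Q (s', 1)⟫) 0 s := by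
      refine (hasDerivAt_const s (0:ℝ)).congr_of_eventuallyEq ?_
      filter_upwards [Icc_mem_nhds hs.1 hs.2] with s' hs1
      exact Submodule.inner_left_of_mem_orthogonal (hconormal s' hs1).1 (hconormal s hs').2
    have := hd.unique hz
    rw [hB]
    simpa using this
  have hBint : ∫ t in (0:ℝ)..1, fderiv ℝ B (s, t) (0, 1) = 0 := by
    rw [intervalIntegral.integral_eq_sub_of_hasDerivAt
      (fun t _ => floer_hasDerivAt_snd hBd s t)
      (floer_ii hcB s 0 1),
      hB0, hB1', sub_zero]
  have hc1 : Continuous fun t : ℝ => -(‖fderiv ℝ Q (s, t) (1, 0)‖ ^ 2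
        + ‖fderiv ℝ P (s, t) (1, 0)‖ ^ 2) := by
    have c1 : Continuous fun t : ℝ => fderiv ℝ Q (s, t) (1, 0) :=
      (hDQ (1, 0)).continuous.comp (by fun_prop : Continuous fun t : ℝ => (s, t))
    have c2 : Continuous fun t : ℝ => fderiv ℝ P (s, t) (1, 0) :=
      (hDP (1, 0)).continuous.comp (by fun_prop : Continuous fun t : ℝ => (s, t))
    exact ((c1.norm.pow 2).add (c2.norm.pow 2)).neg
  have hcong : ∫ t in (0:ℝ)..1, fderiv ℝ F (s, t) (1, 0)
      = ∫ t in (0:ℝ)..1, (-(‖fderiv ℝ Q (s, t) (1, 0)‖ ^ 2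
        + ‖fderiv ℝ P (s, t) (1, 0)‖ ^ 2) - fderiv ℝ B (s, t) (0, 1)) := by
    refine intervalIntegral.integral_congr ?_
    intro t ht
    rw [Set.uIcc_of_le zero_le_one] at ht
    exact hpt s hs' t ht
  show ∫ t in (0:ℝ)..1, fderiv ℝ F (s, t) (1, 0) = -∫ t in (0:ℝ)..1, _
  rw [hcong, intervalIntegral.integral_sub (hc1.intervalIntegrable _ _)
    (floer_ii hcB s 0 1),
    hBint, sub_zero, intervalIntegral.integral_neg]
end

section
/- Let W₀ ⊆ ℝⁿ be a linear subspace and let K : [a,b] × (ℝⁿ × ℝⁿ) × [0,1] → ℝ be a continuously differentiable s-dependent family of Hamiltonians. Let u = (q, p) : [a,b] × [0,1] → ℝⁿ × ℝⁿ be twice continuously differentiable and satisfy the s-dependent Floer equation ∂_s q = −∂_t p − ∇_q K(s, u, t), ∂_s p = ∂_t q − ∇_p K(s, u, t), with boundary conditions p(s, 0) = 0, q(s, 1) ∈ W₀, p(s, 1) ∈ W₀^⊥ for all s ∈ [a,b]. Then 𝒜_{K(b,·,·)}(u(b,·)) − 𝒜_{K(a,·,·)}(u(a,·)) = −∫_a^b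 ∫₀¹ ( ‖∂_s q‖² + ‖∂_s p‖² ) dt ds + ∫_a^b ∫₀¹ (∂K/∂s)(s, u(s,t), t) dt ds. In particular, if |∂K/∂s| ≤ ε everywhere, then 𝒜_{K(b,·,·)}(u(b,·)) ≤ 𝒜_{K(a,·,·)}(u(a,·)) + ε(b − a). -/
open intervalIntegral
open scoped RealInnerProductSpace

section FloerHelpers

variable {E : Type*} [NormedAddCommGroup E] [NormedSpace ℝ E]

lemma floer_hasDerivAt_s {f : ℝ × ℝ → E} {s t : ℝ} (hf : DifferentiableAt ℝ f (s, t)) :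
    HasDerivAt (fun s' => f (s', t)) (fderiv ℝ f (s, t) (1, 0)) s := by
  have h : HasDerivAt (fun s' : ℝ => (s', t)) ((1 : ℝ), (0 : ℝ)) s :=
    (hasDerivAt_id s).prodMk (hasDerivAt_const s t)
  exact HasFDerivAt.comp_hasDerivAt (f := fun s' : ℝ => (s', t)) s hf.hasFDerivAt h

lemma floer_hasDerivAt_t {f : ℝ × ℝ → E} {s t : ℝ} (hf : DifferentiableAt ℝ f (s, t)) :
    HasDerivAt (fun t' => f (s, t')) (fderiv ℝ f (s, t) (0, 1)) t := by
  have h : HasDerivAt (fun t' : ℝ => (s, t')) ((0 : ℝ), (1 : ℝ)) t :=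
    (hasDerivAt_const t s).prodMk (hasDerivAt_id t)
  exact HasFDerivAt.comp_hasDerivAt (f := fun t' : ℝ => (s, t')) t hf.hasFDerivAt h

/-- The derivative at an interior point of a curve in a closed subspace lies in it. -/
lemma floer_deriv_mem [FiniteDimensional ℝ E] (W : Submodule ℝ E) {a b s : ℝ}
    (hs : s ∈ Set.Ioo a b) {f : ℝ → E} {f' : E} (hf : HasDerivAt f f' s)
    (hW : ∀ x ∈ Set.Icc a b, f x ∈ W) : f' ∈ W := by
  have hcl : IsClosed (W : Set E) := W.closed_of_finiteDimensional
  have ht := hasDerivAt_iff_tendsto_slope.1 hf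
  refine hcl.mem_of_tendsto ht ?_
  have : Set.Icc a b ∈ nhds s := Icc_mem_nhds hs.1 hs.2
  filter_upwards [mem_nhdsWithin_of_mem_nhds this] with x hx
  rw [slope_def_module]
  exact W.smul_mem _ (W.sub_mem (hW x hx) (hW s ⟨hs.1.le, hs.2.le⟩))

end FloerHelpers

section FloerHelpers2

variable {E : Type*} [NormedAddCommGroup E] [InnerProductSpace ℝ E] [FiniteDimensional ℝ E]

/-- Splitting the differential of `K` into partial gradients. -/
lemma floer_fderiv_split (K : ℝ × ((E × E) × ℝ) → ℝ) (hK : Differentiable ℝ K)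
    (s t : ℝ) (x y v w : E) :
    fderiv ℝ K (s, ((x, y), t)) (1, ((v, w), 0))
      = deriv (fun s' => K (s', ((x, y), t))) s
        + ⟪gradient (fun q => K (s, ((q, y), t))) x, v⟫
        + ⟪gradient (fun p => K (s, ((x, p), t))) y, w⟫ := by
  have h1 : HasDerivAt (fun s' => K (s', ((x, y), t)))
      (fderiv ℝ K (s, ((x, y), t)) (1, 0)) s := by
    have h : HasDerivAt (fun s' : ℝ => (s', ((x, y), t))) ((1 : ℝ), (0 : (E × E) × ℝ)) s :=
      (hasDerivAt_id s).prodMk (hasDerivAt_const s _)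
    exact HasFDerivAt.comp_hasDerivAt (f := fun s' : ℝ => (s', ((x, y), t))) s
      (hK _).hasFDerivAt h
  have h2 : HasFDerivAt (fun q => K (s, ((q, y), t)))
      ((fderiv ℝ K (s, ((x, y), t))).comp
        ((0 : E →L[ℝ] ℝ).prod (((ContinuousLinearMap.id ℝ E).prod 0).prod 0))) x := by
    have h : HasFDerivAt (fun q : E => (s, ((q, y), t)))
        ((0 : E →L[ℝ] ℝ).prod (((ContinuousLinearMap.id ℝ E).prod (0 : E →L[ℝ] E)).prod
          (0 : E →L[ℝ] ℝ))) x :=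
      (hasFDerivAt_const s x).prodMk (((hasFDerivAt_id x).prodMk (hasFDerivAt_const y x)).prodMk
        (hasFDerivAt_const t x))
    exact HasFDerivAt.comp (f := fun q : E => (s, ((q, y), t))) x (hK _).hasFDerivAt h
  have h3 : HasFDerivAt (fun p => K (s, ((x, p), t)))
      ((fderiv ℝ K (s, ((x, y), t))).comp
        ((0 : E →L[ℝ] ℝ).prod (((0 : E →L[ℝ] E).prod (ContinuousLinearMap.id ℝ E)).prod 0))) y := by
    have h : HasFDerivAt (fun q : E => (s, ((x, q), t)))
        ((0 : E →L[ℝ] ℝ).prod (((0 : E →L[ℝ] E).prod (ContinuousLinearMap.id ℝ E)).prod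
          (0 : E →L[ℝ] ℝ))) y :=
      (hasFDerivAt_const s y).prodMk (((hasFDerivAt_const x y).prodMk (hasFDerivAt_id y)).prodMk
        (hasFDerivAt_const t y))
    exact HasFDerivAt.comp (f := fun q : E => (s, ((x, q), t))) y (hK _).hasFDerivAt h
  rw [h1.deriv, gradient, gradient, InnerProductSpace.toDual_symm_apply,
    InnerProductSpace.toDual_symm_apply, h2.fderiv, h3.fderiv]
  simp only [ContinuousLinearMap.comp_apply, ContinuousLinearMap.prod_apply,
    ContinuousLinearMap.zero_apply, ContinuousLinearMap.id_apply]
  rw [← map_add, ← map_add]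
  congr 1
  ext <;> simp

lemma floer_main
    (W₀ : Submodule ℝ E) (a b : ℝ) (hab : a ≤ b)
    (K : ℝ × ((E × E) × ℝ) → ℝ) (hK : ContDiff ℝ 1 K)
    (q p : ℝ × ℝ → E) (hq : ContDiff ℝ 2 q) (hp : ContDiff ℝ 2 p)
    (hFloer : ∀ s ∈ Set.Icc a b, ∀ t ∈ Set.Icc (0:ℝ) 1,
      deriv (fun s' => q (s', t)) s
        = -(deriv (fun t' => p (s, t')) t)
          - gradient (fun x => K (s, ((x, p (s, t)), t))) (q (s, t)) ∧
      deriv (fun s' => p (s', t)) s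
        = deriv (fun t' => q (s, t')) t
          - gradient (fun y => K (s, ((q (s, t), y), t))) (p (s, t)))
    (hzero : ∀ s ∈ Set.Icc a b, p (s, 0) = 0)
    (hconormal : ∀ s ∈ Set.Icc a b, q (s, 1) ∈ W₀ ∧ p (s, 1) ∈ W₀ᗮ) :
    (-(∫ t in (0:ℝ)..1, ⟪p (b, t), deriv (fun τ => q (b, τ)) t⟫)
        + ∫ t in (0:ℝ)..1, K (b, ((q (b, t), p (b, t)), t)))
      - (-(∫ t in (0:ℝ)..1, ⟪p (a, t), deriv (fun τ => q (a, τ)) t⟫)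
        + ∫ t in (0:ℝ)..1, K (a, ((q (a, t), p (a, t)), t)))
      = -(∫ s in a..b, ∫ t in (0:ℝ)..1,
            (‖deriv (fun s' => q (s', t)) s‖ ^ 2 + ‖deriv (fun s' => p (s', t)) s‖ ^ 2))
        + ∫ s in a..b, ∫ t in (0:ℝ)..1,
            deriv (fun s' => K (s', ((q (s, t), p (s, t)), t))) s := by
  have hqd : Differentiable ℝ q := hq.differentiable (by norm_num)
  have hpd : Differentiable ℝ p := hp.differentiable (by norm_num)
  have hKd : Differentiable ℝ K := hK.differentiable (by norm_num)
  have hq1 : ContDiff ℝ 1 (fderiv ℝ q) := hq.fderiv_right (by norm_num)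
  have hp1 : ContDiff ℝ 1 (fderiv ℝ p) := hp.fderiv_right (by norm_num)
  have hq2 : Continuous (fderiv ℝ (fderiv ℝ q)) := hq1.continuous_fderiv (by norm_num)
  have hq1d : Differentiable ℝ (fderiv ℝ q) := hq1.differentiable (by norm_num)
  have hK1 : Continuous (fderiv ℝ K) := hK.continuous_fderiv (by norm_num)
  have cq := hq.continuous
  have cp := hp.continuous
  have cq1 := hq1.continuous
  have cp1 := hp1.continuous
  have cK := hK.continuous
  have eqs : ∀ s t, deriv (fun s' => q (s', t)) s = fderiv ℝ q (s, t) (1, 0) :=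
    fun s t => (floer_hasDerivAt_s (hqd _)).deriv
  have eqt : ∀ s t, deriv (fun t' => q (s, t')) t = fderiv ℝ q (s, t) (0, 1) :=
    fun s t => (floer_hasDerivAt_t (hqd _)).deriv
  have eps : ∀ s t, deriv (fun s' => p (s', t)) s = fderiv ℝ p (s, t) (1, 0) :=
    fun s t => (floer_hasDerivAt_s (hpd _)).deriv
  have ept : ∀ s t, deriv (fun t' => p (s, t')) t = fderiv ℝ p (s, t) (0, 1) :=
    fun s t => (floer_hasDerivAt_t (hpd _)).deriv
  have eKs : ∀ s t, deriv (fun s' => K (s', ((q (s, t), p (s, t)), t))) s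
      = fderiv ℝ K (s, ((q (s, t), p (s, t)), t)) (1, 0) := by
    intro s t
    have := floer_fderiv_split K hKd s t (q (s, t)) (p (s, t)) 0 0
    simp only [inner_zero_right, add_zero] at this
    exact this.symm
  -- the integrand of the action and its derivative
  let F : ℝ → ℝ → ℝ := fun s t =>
    -⟪p (s, t), fderiv ℝ q (s, t) (0, 1)⟫ + K (s, ((q (s, t), p (s, t)), t))
  let F' : ℝ → ℝ → ℝ := fun s t =>
    -(⟪p (s, t), fderiv ℝ (fderiv ℝ q) (s, t) (1, 0) (0, 1)⟫
        + ⟪fderiv ℝ p (s, t) (1, 0), fderiv ℝ q (s, t) (0, 1)⟫)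
      + fderiv ℝ K (s, ((q (s, t), p (s, t)), t))
          (1, ((fderiv ℝ q (s, t) (1, 0), fderiv ℝ p (s, t) (1, 0)), 0))
  have hF : ∀ s t, HasDerivAt (fun s' => F s' t) (F' s t) s := by
    intro s t
    have h1 : HasDerivAt (fun s' => fderiv ℝ q (s', t) (0, 1))
        (fderiv ℝ (fderiv ℝ q) (s, t) (1, 0) (0, 1)) s := by
      have := (floer_hasDerivAt_s (hq1d (s, t))).clm_apply (hasDerivAt_const s ((0 : ℝ), (1 : ℝ)))
      simpa using this
    have h2 := floer_hasDerivAt_s (hpd (s, t))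
    have h3 := floer_hasDerivAt_s (hqd (s, t))
    have h4 : HasDerivAt (fun s' : ℝ => (s', ((q (s', t), p (s', t)), t)))
        ((1 : ℝ), ((fderiv ℝ q (s, t) (1, 0), fderiv ℝ p (s, t) (1, 0)), (0 : ℝ))) s :=
      (hasDerivAt_id s).prodMk ((h3.prodMk h2).prodMk (hasDerivAt_const s t))
    have h5 := HasFDerivAt.comp_hasDerivAt (f := fun s' : ℝ => (s', ((q (s', t), p (s', t)), t)))
      s (hKd _).hasFDerivAt h4
    exact (h2.inner ℝ h1).neg.add h5
  have cF' : Continuous (Function.uncurry F') := by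
    simp only [F', Function.uncurry_def]
    fun_prop
  -- the boundary term
  let G : ℝ → ℝ → ℝ := fun s t => ⟪p (s, t), fderiv ℝ q (s, t) (1, 0)⟫
  let G' : ℝ → ℝ → ℝ := fun s t =>
    ⟪p (s, t), fderiv ℝ (fderiv ℝ q) (s, t) (0, 1) (1, 0)⟫
        + ⟪fderiv ℝ p (s, t) (0, 1), fderiv ℝ q (s, t) (1, 0)⟫
  have hG : ∀ s t, HasDerivAt (fun t' => G s t') (G' s t) t := by
    intro s t
    have h1 : HasDerivAt (fun t' => fderiv ℝ q (s, t') (1, 0))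
        (fderiv ℝ (fderiv ℝ q) (s, t) (0, 1) (1, 0)) t := by
      have := (floer_hasDerivAt_t (hq1d (s, t))).clm_apply (hasDerivAt_const t ((1 : ℝ), (0 : ℝ)))
      simpa using this
    exact (floer_hasDerivAt_t (hpd (s, t))).inner ℝ h1
  have cG' : ∀ s, Continuous (G' s) := by
    intro s
    simp only [G']
    fun_prop
  have hsymm : ∀ z, fderiv ℝ (fderiv ℝ q) z (1, 0) (0, 1)
      = fderiv ℝ (fderiv ℝ q) z (0, 1) (1, 0) := fun z =>
    (hq.contDiffAt.isSymmSndFDerivAt (by simp)).eq _ _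
  let T : ℝ → ℝ → ℝ := fun s t =>
    ‖fderiv ℝ q (s, t) (1, 0)‖ ^ 2 + ‖fderiv ℝ p (s, t) (1, 0)‖ ^ 2
  let D : ℝ → ℝ → ℝ := fun s t => fderiv ℝ K (s, ((q (s, t), p (s, t)), t)) (1, 0)
  have cT : Continuous (Function.uncurry T) := by
    simp only [T, Function.uncurry_def]; fun_prop
  have cD : Continuous (Function.uncurry D) := by
    simp only [D, Function.uncurry_def]; fun_prop
  have cTs : ∀ s, Continuous (T s) := fun s => cT.comp (by fun_prop : Continuous fun t => (s, t))
  have cDs : ∀ s, Continuous (D s) := fun s => cD.comp (by fun_prop : Continuous fun t => (s, t))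
  have key : ∀ s ∈ Set.Icc a b, ∀ t ∈ Set.Icc (0:ℝ) 1, F' s t = -T s t + D s t - G' s t := by
    intro s hs t ht
    obtain ⟨e1, e2⟩ := hFloer s hs t ht
    rw [eqs, ept] at e1
    rw [eps, eqt] at e2
    have g1 : gradient (fun x => K (s, ((x, p (s, t)), t))) (q (s, t))
        = -fderiv ℝ p (s, t) (0, 1) - fderiv ℝ q (s, t) (1, 0) := by rw [e1]; abel
    have g2 : gradient (fun y => K (s, ((q (s, t), y), t))) (p (s, t))
        = fderiv ℝ q (s, t) (0, 1) - fderiv ℝ p (s, t) (1, 0) := by rw [e2]; abel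
    simp only [F', G', T, D]
    rw [floer_fderiv_split K hKd, eKs, g1, g2, hsymm]
    simp only [inner_sub_left, inner_neg_left, real_inner_self_eq_norm_sq]
    rw [real_inner_comm (fderiv ℝ p (s, t) (1, 0)) (fderiv ℝ q (s, t) (0, 1))]
    ring
  have bdry : ∀ s ∈ Set.Ioo a b, ∫ t in (0:ℝ)..1, G' s t = 0 := by
    intro s hs
    have hs' : s ∈ Set.Icc a b := ⟨hs.1.le, hs.2.le⟩
    rw [intervalIntegral.integral_eq_sub_of_hasDerivAt (fun t _ => hG s t)
      ((cG' s).intervalIntegrable _ _)]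
    have hm : fderiv ℝ q (s, 1) (1, 0) ∈ W₀ :=
      floer_deriv_mem W₀ hs (floer_hasDerivAt_s (hqd (s, 1))) (fun x hx => (hconormal x hx).1)
    simp only [G]
    rw [hzero s hs', Submodule.inner_left_of_mem_orthogonal hm (hconormal s hs').2]
    simp
  have inner_eq : ∀ s ∈ Set.Ioo a b, ∫ t in (0:ℝ)..1, F' s t
      = -(∫ t in (0:ℝ)..1, T s t) + ∫ t in (0:ℝ)..1, D s t := by
    intro s hs
    have : ∫ t in (0:ℝ)..1, F' s t = ∫ t in (0:ℝ)..1, (-T s t + D s t - G' s t) := by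
      apply intervalIntegral.integral_congr
      intro t ht
      rw [Set.uIcc_of_le zero_le_one] at ht
      exact key s ⟨hs.1.le, hs.2.le⟩ t ht
    have c1 : Continuous fun t => -T s t := (cTs s).neg
    have c2 : Continuous fun t => -T s t + D s t := c1.add (cDs s)
    rw [this, intervalIntegral.integral_sub
        (c2.intervalIntegrable _ _) ((cG' s).intervalIntegrable _ _),
      bdry s hs, sub_zero, intervalIntegral.integral_add (c1.intervalIntegrable _ _)
        ((cDs s).intervalIntegrable _ _), intervalIntegral.integral_neg]
  have act : ∀ s, -(∫ t in (0:ℝ)..1, ⟪p (s, t), deriv (fun τ => q (s, τ)) t⟫)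
        + ∫ t in (0:ℝ)..1, K (s, ((q (s, t), p (s, t)), t)) = ∫ t in (0:ℝ)..1, F s t := by
    intro s
    simp only [eqt, F]
    rw [intervalIntegral.integral_add, intervalIntegral.integral_neg]
    · exact Continuous.intervalIntegrable (by fun_prop) _ _
    · exact Continuous.intervalIntegrable (by fun_prop) _ _
  have cFs : ∀ s, Continuous (F s) := by
    intro s
    simp only [F]
    fun_prop
  rw [act, act, ← intervalIntegral.integral_sub ((cFs b).intervalIntegrable _ _)
    ((cFs a).intervalIntegrable _ _)]
  have ftc : ∀ t, F b t - F a t = ∫ s in a..b, F' s t := by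
    intro t
    rw [intervalIntegral.integral_eq_sub_of_hasDerivAt (fun s _ => hF s t)]
    exact (cF'.comp (by fun_prop : Continuous fun s => (s, t))).intervalIntegrable _ _
  simp only [ftc, eqs, eps, eKs]
  have swap : ∫ t in (0:ℝ)..1, ∫ s in a..b, F' s t = ∫ s in a..b, ∫ t in (0:ℝ)..1, F' s t := by
    refine MeasureTheory.intervalIntegral_intervalIntegral_swap ?_
    have c : Continuous (Function.uncurry fun t s => F' s t) :=
      cF'.comp continuous_swap
    exact (c.continuousOn.integrableOn_compact (isCompact_uIcc.prod isCompact_uIcc)).mono_set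
      (Set.prod_mono Set.uIoc_subset_uIcc Set.uIoc_subset_uIcc)
  have cTi : Continuous fun s => ∫ t in (0:ℝ)..1, T s t :=
    intervalIntegral.continuous_parametric_intervalIntegral_of_continuous' cT 0 1
  have cDi : Continuous fun s => ∫ t in (0:ℝ)..1, D s t :=
    intervalIntegral.continuous_parametric_intervalIntegral_of_continuous' cD 0 1
  have cTn : Continuous fun s => -∫ t in (0:ℝ)..1, T s t := cTi.neg
  change _ = -(∫ s in a..b, ∫ t in (0:ℝ)..1, T s t) + ∫ s in a..b, ∫ t in (0:ℝ)..1, D s t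
  rw [swap, ← intervalIntegral.integral_neg, ← intervalIntegral.integral_add
    (cTn.intervalIntegrable _ _) (cDi.intervalIntegrable _ _)]
  rw [intervalIntegral.integral_of_le hab, intervalIntegral.integral_of_le hab,
    MeasureTheory.integral_Ioc_eq_integral_Ioo, MeasureTheory.integral_Ioc_eq_integral_Ioo]
  exact MeasureTheory.setIntegral_congr_fun measurableSet_Ioo inner_eq

end FloerHelpers2

/-- For a solution `u = (q,p)` of the `s`-dependent Floer equation
`∂ₛq = -∂ₜp - ∇_q K(s,u,t)`, `∂ₛp = ∂ₜq - ∇_p K(s,u,t)` with boundary conditions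
`p(s,0) = 0`, `q(s,1) ∈ W₀`, `p(s,1) ∈ W₀^⊥`, one has
`𝒜_{K(b)}(u(b,·)) - 𝒜_{K(a)}(u(a,·))
  = -∫_a^b ∫₀¹ (‖∂ₛq‖² + ‖∂ₛp‖²) dt ds + ∫_a^b ∫₀¹ ∂K/∂s (s, u(s,t), t) dt ds`;
in particular if `|∂K/∂s| ≤ ε` everywhere then
`𝒜_{K(b)}(u(b,·)) ≤ 𝒜_{K(a)}(u(a,·)) + ε (b - a)`. -/
theorem action_estimate_along_sDependent_Floer_strip (n : ℕ)
    (W₀ : Submodule ℝ (EuclideanSpace ℝ (Fin n)))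
    (a b : ℝ) (hab : a ≤ b) (ε : ℝ) (hε : 0 ≤ ε)
    (K : ℝ × ((EuclideanSpace ℝ (Fin n) × EuclideanSpace ℝ (Fin n)) × ℝ) → ℝ)
    (hK : ContDiff ℝ 1 K)
    (u : ℝ × ℝ → EuclideanSpace ℝ (Fin n) × EuclideanSpace ℝ (Fin n))
    (hu : ContDiff ℝ 2 u)
    (hFloer : ∀ s ∈ Set.Icc a b, ∀ t ∈ Set.Icc (0:ℝ) 1,
      deriv (fun s' => (u (s', t)).1) s
        = -(deriv (fun t' => (u (s, t')).2) t)
          - gradient (fun q => K (s, ((q, (u (s, t)).2), t))) (u (s, t)).1 ∧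
      deriv (fun s' => (u (s', t)).2) s
        = deriv (fun t' => (u (s, t')).1) t
          - gradient (fun p => K (s, (((u (s, t)).1, p), t))) (u (s, t)).2)
    (hzero : ∀ s ∈ Set.Icc a b, (u (s, 0)).2 = 0)
    (hconormal : ∀ s ∈ Set.Icc a b, (u (s, 1)).1 ∈ W₀ ∧ (u (s, 1)).2 ∈ W₀ᗮ) :
    (actionFunctional (fun x => K (b, x)) (fun t => u (b, t))
        - actionFunctional (fun x => K (a, x)) (fun t => u (a, t))
      = -(∫ s in a..b, ∫ t in (0:ℝ)..1,
            (‖deriv (fun s' => (u (s', t)).1) s‖ ^ 2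
              + ‖deriv (fun s' => (u (s', t)).2) s‖ ^ 2))
        + ∫ s in a..b, ∫ t in (0:ℝ)..1,
            deriv (fun s' => K (s', (u (s, t), t))) s) ∧
    ((∀ (s : ℝ) (x : EuclideanSpace ℝ (Fin n) × EuclideanSpace ℝ (Fin n)) (t : ℝ),
        |deriv (fun s' => K (s', (x, t))) s| ≤ ε) →
      actionFunctional (fun x => K (b, x)) (fun t => u (b, t))
        ≤ actionFunctional (fun x => K (a, x)) (fun t => u (a, t)) + ε * (b - a)) := by
  have hmain := floer_main W₀ a b hab K hK (fun z => (u z).1) (fun z => (u z).2)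
    hu.fst hu.snd hFloer hzero hconormal
  refine ⟨hmain, fun hbd => ?_⟩
  have h1 : 0 ≤ ∫ s in a..b, ∫ t in (0:ℝ)..1,
      (‖deriv (fun s' => (u (s', t)).1) s‖ ^ 2 + ‖deriv (fun s' => (u (s', t)).2) s‖ ^ 2) := by
    refine intervalIntegral.integral_nonneg hab fun s _ => ?_
    refine intervalIntegral.integral_nonneg zero_le_one fun t _ => ?_
    positivity
  have h2 : ‖∫ s in a..b, ∫ t in (0:ℝ)..1, deriv (fun s' => K (s', (u (s, t), t))) s‖
      ≤ ε * |b - a| := by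
    refine intervalIntegral.norm_integral_le_of_norm_le_const fun s _ => ?_
    have := intervalIntegral.norm_integral_le_of_norm_le_const (a := (0:ℝ)) (b := 1) (C := ε)
      (f := fun t => deriv (fun s' => K (s', (u (s, t), t))) s) (fun t _ => hbd s (u (s, t)) t)
    simpa using this
  rw [abs_of_nonneg (sub_nonneg.2 hab)] at h2
  have h3 := (le_abs_self _).trans h2
  have h4 : actionFunctional (fun x => K (b, x)) (fun t => u (b, t))
        - actionFunctional (fun x => K (a, x)) (fun t => u (a, t))
      = -(∫ s in a..b, ∫ t in (0:ℝ)..1,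
            (‖deriv (fun s' => (u (s', t)).1) s‖ ^ 2
              + ‖deriv (fun s' => (u (s', t)).2) s‖ ^ 2))
        + ∫ s in a..b, ∫ t in (0:ℝ)..1,
            deriv (fun s' => K (s', (u (s, t), t))) s := hmain
  linarith
end
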